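/- Explicit q-Lommel polynomial evaluation for J^{(2)}: for m ≥ 1 and n = 0, the coefficient R^{(2)}_{m,0,ν}(x;q) of Theorem 5 simplifies, via the q-Chu–Vandermonde summation, to R^{(2)}_{m,0,ν}(x;q) = Σ_{j=0}^{⌊m/2⌋} (x/2)^{2j−m} (−1)^j [(q^{ν};q)_{m−j} (q;q)_{m−j} / ((q;q)_j (q^{ν};q)_j (q;q)_{m−2j})] q^{j(ν+j−1)}. -/

import Mathlib

open scoped BigOperators

/-- q-shifted factorial (a;q)_j -/
noncomputable def qPoch (a q : ℂ) (j : ℕ) : ℂ :=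
  ∏ i ∈ Finset.range j, (1 - a * q ^ i)

/-- infinite q-shifted factorial (a;q)_∞ -/
noncomputable def qPochInf (a q : ℂ) : ℂ :=
  ∏' j : ℕ, (1 - a * q ^ j)

/-- basic hypergeometric series ₁φ₁(a; c; q, x) -/
noncomputable def phi11 (a c q x : ℂ) : ℂ :=
  ∑' j : ℕ, qPoch a q j / (qPoch q q j * qPoch c q j) *
    (-1) ^ j * q ^ (j * (j - 1) / 2) * x ^ j

/-- basic hypergeometric series ₀φ₁(–; c; q, x) -/
noncomputable def phi01 (c q x : ℂ) : ℂ :=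
  ∑' j : ℕ, q ^ (j * (j - 1)) * x ^ j / (qPoch q q j * qPoch c q j)

/-- basic hypergeometric series ₂φ₁(a, b; c; q, x) -/
noncomputable def phi21 (a b c q x : ℂ) : ℂ :=
  ∑' j : ℕ, qPoch a q j * qPoch b q j / (qPoch q q j * qPoch c q j) * x ^ j

/-- Jackson's second q-Bessel function. -/
noncomputable def J2 (q ν : ℝ) (x : ℂ) : ℂ :=
  (qPochInf ((q ^ (ν + 1) : ℝ) : ℂ) (q : ℂ) / qPochInf (q : ℂ) (q : ℂ))
    * (x / 2) ^ (ν : ℂ)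
    * phi01 ((q ^ (ν + 1) : ℝ) : ℂ) (q : ℂ) (-(x ^ 2) * ((q ^ (ν + 1) : ℝ) : ℂ) / 4)


/-- The q-Lommel polynomial R^{(2)}_{m,0,ν}(x;q) in its explicit form. -/
noncomputable def R2 (q : ℝ) (m : ℕ) (ν : ℝ) (x : ℂ) : ℂ :=
  ∑ j ∈ Finset.range (m / 2 + 1),
    (x / 2) ^ (2 * (j : ℤ) - (m : ℤ)) * (-1) ^ j *
      (qPoch ((q ^ ν : ℝ) : ℂ) (q : ℂ) (m - j) * qPoch (q : ℂ) (q : ℂ) (m - j) /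
        (qPoch (q : ℂ) (q : ℂ) j * qPoch ((q ^ ν : ℝ) : ℂ) (q : ℂ) j *
          qPoch (q : ℂ) (q : ℂ) (m - 2 * j))) *
      ((q ^ ((j : ℝ) * (ν + (j : ℝ) - 1)) : ℝ) : ℂ)


lemma qPoch_zero' (a q : ℂ) : qPoch a q 0 = 1 := by simp [qPoch]

lemma qPoch_succ' (a q : ℂ) (j : ℕ) : qPoch a q (j + 1) = qPoch a q j * (1 - a * q ^ j) := by
  simp [qPoch, Finset.prod_range_succ]

lemma qPoch_shift (a q : ℂ) (j : ℕ) : qPoch a q (j + 1) = (1 - a) * qPoch (a * q) q j := by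
  simp only [qPoch, Finset.prod_range_succ', pow_zero, mul_one]
  rw [mul_comm]
  congr 1
  apply Finset.prod_congr rfl
  intro i _
  ring

lemma qPoch_ne (a q : ℂ) (h : ∀ i : ℕ, 1 - a * q ^ i ≠ 0) (j : ℕ) : qPoch a q j ≠ 0 := by
  rw [qPoch, Finset.prod_ne_zero_iff]
  intro i _
  exact h i

lemma qPochInf_shift (a q : ℂ) (hq : ‖q‖ < 1) :
    qPochInf a q = (1 - a) * qPochInf (a * q) q := by
  have hs : Summable (fun j : ℕ => ‖-(a * q * q ^ j)‖) := by
    simp only [norm_neg, norm_mul, norm_pow]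
    exact (summable_geometric_of_lt_one (norm_nonneg _) hq).mul_left _
  have hm := multipliable_one_add_of_summable hs
  have he : (fun j : ℕ => 1 + -(a * q * q ^ j)) = (fun j : ℕ => 1 - a * q ^ (j + 1)) := by
    funext j
    ring
  have he' : (fun j : ℕ => 1 - a * q * q ^ j) = (fun j : ℕ => 1 - a * q ^ (j + 1)) := by
    funext j
    ring
  rw [he] at hm
  have h := tprod_eq_zero_mul' (f := fun j : ℕ => 1 - a * q ^ j) hm
  unfold qPochInf
  rw [h, he', pow_zero, mul_one]

lemma summable_phi01 (c q x : ℂ) (hq : ‖q‖ < 1) (hq0 : q ≠ 0) (hx : x ≠ 0)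
    (hqq : ∀ i : ℕ, 1 - q * q ^ i ≠ 0) (hc : ∀ i : ℕ, 1 - c * q ^ i ≠ 0) :
    Summable (fun j : ℕ => q ^ (j * (j - 1)) * x ^ j / (qPoch q q j * qPoch c q j)) := by
  have hQ := qPoch_ne q q hqq
  have hC := qPoch_ne c q hc
  apply summable_of_ratio_test_tendsto_lt_one (l := 0) zero_lt_one
  · filter_upwards with j
    exact div_ne_zero (mul_ne_zero (pow_ne_zero _ hq0) (pow_ne_zero _ hx))
      (mul_ne_zero (hQ j) (hC j))
  · have hp : Filter.Tendsto (fun j : ℕ => q ^ j) Filter.atTop (nhds 0) :=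
      tendsto_pow_atTop_nhds_zero_of_norm_lt_one hq
    have key : Filter.Tendsto
        (fun j : ℕ => ‖(q ^ j * q ^ j * x) / ((1 - q * q ^ j) * (1 - c * q ^ j))‖)
        Filter.atTop (nhds ‖((0:ℂ) * 0 * x) / ((1 - q * 0) * (1 - c * 0))‖) := by
      apply Filter.Tendsto.norm
      apply Filter.Tendsto.div
      · exact (hp.mul hp).mul_const x
      · exact (tendsto_const_nhds.sub (hp.const_mul q)).mul
          (tendsto_const_nhds.sub (hp.const_mul c))
      · simp
    simp only [mul_zero, zero_mul, zero_div, norm_zero] at key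
    refine key.congr ?_
    intro j
    rw [← norm_div]
    congr 1
    have e : q ^ ((j + 1) * (j + 1 - 1)) = q ^ (j * (j - 1)) * (q ^ j * q ^ j) := by
      rw [← pow_add, ← pow_add]
      congr 1
      rcases j with _ | j
      · simp
      · simp only [Nat.add_sub_cancel]
        ring
    rw [e, qPoch_succ', qPoch_succ']
    have := hQ j
    have := hC j
    have := hqq j
    have := hc j
    have := pow_ne_zero (j * (j - 1)) hq0
    have := pow_ne_zero j hx
    field_simp
    try ring

/-- contiguous relation for the series -/
lemma phi01_contig (c q w : ℂ) (hq : ‖q‖ < 1) (hq0 : q ≠ 0) (hw : w ≠ 0) (hc0 : c ≠ 0)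
    (hqq : ∀ i : ℕ, 1 - q * q ^ i ≠ 0) (hc : ∀ i : ℕ, 1 - c * q ^ i ≠ 0) :
    -(w * c) * phi01 (c * q * q) q (w * (c * q * q)) =
      (1 - c) * (1 - c * q) * (phi01 (c * q) q (w * (c * q)) - phi01 c q (w * c)) := by
  have hc1 : ∀ i : ℕ, 1 - c * q * q ^ i ≠ 0 := by
    intro i h
    apply hc (i + 1)
    rw [← h]
    ring
  have hc2 : ∀ i : ℕ, 1 - c * q * q * q ^ i ≠ 0 := by
    intro i h
    apply hc (i + 2)
    rw [← h]
    ring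
  have s0 := summable_phi01 c q (w * c) hq hq0 (by positivity) hqq hc
  have s1 := summable_phi01 (c * q) q (w * (c * q)) hq hq0 (by positivity) hqq hc1
  unfold phi01
  rw [← s1.tsum_sub s0, ← tsum_mul_left, ← tsum_mul_left]
  rw [((s1.sub s0).mul_left ((1 - c) * (1 - c * q))).tsum_eq_zero_add]
  simp only [qPoch_zero', pow_zero, zero_mul, mul_one, div_one, sub_self, mul_zero, zero_add]
  apply tsum_congr
  intro i
  have e : q ^ ((i + 1) * (i + 1 - 1)) = q ^ (i * (i - 1)) * (q ^ i * q ^ i) := by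
    rw [← pow_add, ← pow_add]
    congr 1
    rcases i with _ | j
    · simp
    · simp only [Nat.add_sub_cancel]
      ring
  have f1 := qPoch_shift c q (i + 1)
  have f2 := qPoch_shift (c * q) q i
  have f3 := qPoch_succ' (c * q) q i
  have g2 := qPoch_ne _ q hc2 i
  have g1 := qPoch_ne _ q hc1 i
  have g0 := qPoch_ne _ q hc i
  have gq := qPoch_ne _ q hqq i
  have h0 := hc 0
  have h1 := hc1 0
  have hi := hc1 i
  have hqi := hqq i
  simp only [pow_zero, mul_one] at h0 h1
  have f4 : qPoch c q (i + 1) = (1 - c) * (1 - c * q) * qPoch (c * q * q) q i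
      / (1 - c * q * q ^ i) := by
    rw [eq_div_iff hi, mul_assoc (1 - c), ← f2, ← f1, qPoch_succ' c q (i + 1)]
    ring
  rw [e, f2, f4, qPoch_succ' q q i]
  simp only [mul_pow, pow_succ]
  generalize q ^ (i * (i - 1)) = E at *
  generalize qPoch (c * q * q) q i = X at *
  generalize qPoch q q i = Y at *
  generalize q ^ i = y at *
  have hqi' : 1 - y * q ≠ 0 := by rwa [mul_comm]
  field_simp
  ring

/-- zero-extended summand of the explicit polynomial -/
noncomputable def lomT (a q t : ℂ) (m j : ℕ) : ℂ :=
  if 2 * j ≤ m then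
    t ^ (m - 2 * j) * (-1) ^ j *
      (qPoch a q (m - j) * qPoch q q (m - j) / (qPoch q q j * qPoch a q j * qPoch q q (m - 2 * j)))
      * (a ^ j * q ^ (j * (j - 1)))
  else 0

noncomputable def lomR (a q t : ℂ) (m : ℕ) : ℂ := ∑ j ∈ Finset.range (m / 2 + 1), lomT a q t m j

lemma lomR_ext (a q t : ℂ) (m N : ℕ) (h : m / 2 + 1 ≤ N) :
    lomR a q t m = ∑ j ∈ Finset.range N, lomT a q t m j := by
  unfold lomR
  apply Finset.sum_subset
  · intro j hj
    simp only [Finset.mem_range] at *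
    omega
  · intro j _ hj
    simp only [Finset.mem_range] at hj
    unfold lomT
    rw [if_neg (by omega)]

lemma lomT_zero (a q t : ℂ) (hqq : ∀ i : ℕ, 1 - q * q ^ i ≠ 0) (m : ℕ) :
    lomT a q t m 0 = t ^ m * qPoch a q m := by
  have := qPoch_ne q q hqq m
  simp [lomT, qPoch_zero', this]

lemma lomT_succ (a q t : ℂ) (hqq : ∀ i : ℕ, 1 - q * q ^ i ≠ 0) (ha : ∀ i : ℕ, 1 - a * q ^ i ≠ 0)
    (m j : ℕ) : lomT a q t (m + 2) (j + 1) =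
      t * (1 - a * q ^ (m + 1)) * lomT a q t (m + 1) (j + 1) - a * q ^ m * lomT a q t m j := by
  have e : q ^ ((j + 1) * (j + 1 - 1)) = q ^ (j * (j - 1)) * (q ^ j * q ^ j) := by
    rw [← pow_add, ← pow_add]
    congr 1
    rcases j with _ | j
    · simp
    · simp only [Nat.add_sub_cancel]
      ring
  have hQ := qPoch_ne q q hqq
  have hA := qPoch_ne a q ha
  rcases lt_trichotomy m (2 * j) with h | h | h
  · unfold lomT
    rw [if_neg (by omega), if_neg (by omega), if_neg (by omega)]
    simp
  · subst h
    unfold lomT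
    rw [if_pos (by omega), if_neg (by omega), if_pos (by omega), e]
    rw [show 2 * j + 2 - 2 * (j + 1) = 0 by omega, show 2 * j - 2 * j = 0 by omega,
      show 2 * j + 2 - (j + 1) = j + 1 by omega, show 2 * j - j = j by omega]
    rw [qPoch_zero', qPoch_succ', qPoch_succ']
    have := hQ j
    have := hA j
    have := hqq j
    have := ha j
    rw [two_mul, pow_add q j j]
    generalize q ^ (j * (j - 1)) = E at *
    generalize qPoch a q j = X at *
    generalize qPoch q q j = Y at *
    generalize q ^ j = y at *
    have hqi' : 1 - y * q ≠ 0 := by rwa [mul_comm]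
    field_simp
    try ring
  · obtain ⟨k, rfl⟩ := Nat.exists_eq_add_of_lt h
    unfold lomT
    rw [if_pos (by omega), if_pos (by omega), if_pos (by omega), e]
    rw [show 2 * j + k + 1 + 2 - 2 * (j + 1) = k + 1 by omega,
      show 2 * j + k + 1 + 1 - 2 * (j + 1) = k by omega,
      show 2 * j + k + 1 - 2 * j = k + 1 by omega,
      show 2 * j + k + 1 + 2 - (j + 1) = (j + k + 1) + 1 by omega,
      show 2 * j + k + 1 + 1 - (j + 1) = j + k + 1 by omega,
      show 2 * j + k + 1 - j = j + k + 1 by omega]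
    rw [qPoch_succ' a q (j + k + 1), qPoch_succ' q q (j + k + 1), qPoch_succ' q q j,
      qPoch_succ' a q j, qPoch_succ' q q k]
    have := hQ j
    have := hA j
    have := hqq j
    have := ha j
    have := hQ k
    have := hqq k
    generalize qPoch a q (j + k + 1) = X at *
    generalize qPoch q q (j + k + 1) = Y at *
    field_simp
    ring

lemma lomR_rec (a q t : ℂ) (hqq : ∀ i : ℕ, 1 - q * q ^ i ≠ 0) (ha : ∀ i : ℕ, 1 - a * q ^ i ≠ 0)
    (m : ℕ) : lomR a q t (m + 2) =
      t * (1 - a * q ^ (m + 1)) * lomR a q t (m + 1) - a * q ^ m * lomR a q t m := by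
  rw [lomR_ext a q t (m + 2) (m + 3 + 1) (by omega), lomR_ext a q t (m + 1) (m + 3 + 1) (by omega),
    lomR_ext a q t m (m + 3) (by omega)]
  rw [Finset.sum_range_succ', Finset.sum_range_succ' _ (m + 3)]
  simp only [lomT_succ a q t hqq ha, lomT_zero a q t hqq, Finset.sum_sub_distrib,
    ← Finset.mul_sum]
  rw [qPoch_succ' a q (m + 1)]
  ring

lemma lomR_zero (a q t : ℂ) : lomR a q t 0 = 1 := by
  simp [lomR, lomT, qPoch_zero']

lemma lomR_one (a q t : ℂ) (hqq : ∀ i : ℕ, 1 - q * q ^ i ≠ 0) : lomR a q t 1 = t * (1 - a) := by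
  simp [lomR, lomT_zero a q t hqq, qPoch_succ', qPoch_zero']

lemma R2_eq (q ν : ℝ) (h0 : 0 < q) (m : ℕ) (x : ℂ) :
    R2 q m ν x = lomR ((q ^ ν : ℝ) : ℂ) (q : ℂ) (x / 2)⁻¹ m := by
  unfold R2 lomR
  apply Finset.sum_congr rfl
  intro j hj
  simp only [Finset.mem_range] at hj
  unfold lomT
  rw [if_pos (by omega)]
  have e1 : (x / 2) ^ (2 * (j : ℤ) - (m : ℤ)) = (x / 2)⁻¹ ^ (m - 2 * j) := by
    rw [← zpow_natCast, inv_zpow', Nat.cast_sub (by omega)]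
    congr 1
    push_cast
    ring
  have e2 : ((q ^ ((j : ℝ) * (ν + (j : ℝ) - 1)) : ℝ) : ℂ)
      = ((q ^ ν : ℝ) : ℂ) ^ j * (q : ℂ) ^ (j * (j - 1)) := by
    rw [← Complex.ofReal_pow, ← Complex.ofReal_pow, ← Complex.ofReal_mul]
    congr 1
    rw [← Real.rpow_natCast (q ^ ν), ← Real.rpow_mul h0.le, ← Real.rpow_natCast q,
      ← Real.rpow_add h0]
    congr 1
    rcases j with _ | j
    · simp
    · simp only [Nat.add_sub_cancel]
      push_cast
      ring
  rw [e1, e2]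

lemma J2_rec (q μ : ℝ) (x : ℂ) (h0 : 0 < q) (h1 : q < 1) (hx : x ≠ 0)
    (hμ : ∀ n : ℕ, q ^ (μ + n) ≠ 1) :
    ((q ^ μ : ℝ) : ℂ) * J2 q (μ + 1) x
      = (x / 2)⁻¹ * (1 - ((q ^ μ : ℝ) : ℂ)) * J2 q μ x - J2 q (μ - 1) x := by
  have hq : ‖(q : ℂ)‖ < 1 := by
    rw [Complex.norm_real, Real.norm_of_nonneg h0.le]
    exact h1
  have hq0 : (q : ℂ) ≠ 0 := by exact_mod_cast h0.ne'
  have hqq : ∀ i : ℕ, 1 - (q : ℂ) * (q : ℂ) ^ i ≠ 0 := by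
    intro i h
    have h' : q ^ (i + 1) = 1 := by
      have : (q : ℂ) ^ (i + 1) = 1 := by
        rw [pow_succ']
        exact (sub_eq_zero.mp h).symm
      exact_mod_cast this
    exact (pow_lt_one₀ h0.le h1 (Nat.succ_ne_zero i)).ne h'
  have hc : ∀ i : ℕ, 1 - ((q ^ μ : ℝ) : ℂ) * (q : ℂ) ^ i ≠ 0 := by
    intro i h
    apply hμ i
    rw [Real.rpow_add h0, Real.rpow_natCast]
    exact_mod_cast (sub_eq_zero.mp h).symm
  have hc0 : ((q ^ μ : ℝ) : ℂ) ≠ 0 := by exact_mod_cast (Real.rpow_pos_of_pos h0 μ).ne'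
  have hz : x / 2 ≠ 0 := div_ne_zero hx two_ne_zero
  have p1 : ((q ^ (μ + 1) : ℝ) : ℂ) = ((q ^ μ : ℝ) : ℂ) * q := by
    rw [Real.rpow_add h0, Real.rpow_one]
    push_cast
    rfl
  have p2 : ((q ^ (μ + 1 + 1) : ℝ) : ℂ) = ((q ^ μ : ℝ) : ℂ) * q * q := by
    rw [Real.rpow_add h0, Real.rpow_one, Complex.ofReal_mul, p1]
  unfold J2
  rw [p2, p1, sub_add_cancel]
  generalize ((q ^ μ : ℝ) : ℂ) = c at *
  have hk := phi01_contig c q (-(x / 2) ^ 2) hq hq0 (by simpa using hx) hc0 hqq hc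
  have a1 : ∀ d : ℂ, -(x ^ 2) * d / 4 = -(x / 2) ^ 2 * d := by
    intro d
    ring
  simp only [a1]
  rw [qPochInf_shift c q hq, qPochInf_shift (c * q) q hq]
  push_cast
  rw [Complex.cpow_add _ _ hz, Complex.cpow_sub _ _ hz, Complex.cpow_one]
  generalize phi01 c q _ = P0 at *
  generalize phi01 (c * q) q _ = P1 at *
  generalize phi01 (c * q * q) q _ = P2 at *
  generalize (x / 2) ^ (μ : ℂ) = Z at *
  generalize x / 2 = z at *
  have hzi : z * z⁻¹ = 1 := mul_inv_cancel₀ hz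
  simp only [div_eq_mul_inv]
  generalize qPochInf (c * q * q) q = I at *
  generalize (qPochInf (q : ℂ) q)⁻¹ = B at *
  generalize z⁻¹ = t at *
  linear_combination (I * B * Z * t) * hk - c * I * B * Z * P2 * z * hzi

theorem J2_qLommel_recurrence (q ν : ℝ) (x : ℂ) (m : ℕ) (hm : 1 ≤ m)
    (h0 : 0 < q) (h1 : q < 1) (hx : x ≠ 0)
    (hν : ∀ n : ℕ, q ^ (ν - 1 + n) ≠ 1) :
    ((q ^ ((m : ℝ) * ν + ((m * (m - 1) / 2 : ℕ) : ℝ)) : ℝ) : ℂ) * J2 q (ν + m) x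
      = R2 q m ν x * J2 q ν x - R2 q (m - 1) (ν + 1) x * J2 q (ν - 1) x := by
  
  have hqq : ∀ i : ℕ, 1 - (q : ℂ) * (q : ℂ) ^ i ≠ 0 := by
    intro i h
    have h' : q ^ (i + 1) = 1 := by
      have : (q : ℂ) ^ (i + 1) = 1 := by
        rw [pow_succ']
        exact (sub_eq_zero.mp h).symm
      exact_mod_cast this
    exact (pow_lt_one₀ h0.le h1 (Nat.succ_ne_zero i)).ne h'
  have hν0 : ∀ n : ℕ, q ^ (ν + n) ≠ 1 := by
    intro n
    have := hν (n + 1)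
    push_cast at this
    rwa [show ν - 1 + ((n : ℝ) + 1) = ν + n by ring] at this
  have hc : ∀ i : ℕ, 1 - ((q ^ ν : ℝ) : ℂ) * (q : ℂ) ^ i ≠ 0 := by
    intro i h
    apply hν0 i
    rw [Real.rpow_add h0, Real.rpow_natCast]
    exact_mod_cast (sub_eq_zero.mp h).symm
  have p1 : ((q ^ (ν + 1) : ℝ) : ℂ) = ((q ^ ν : ℝ) : ℂ) * q := by
    rw [Real.rpow_add h0, Real.rpow_one]
    push_cast
    rfl
  have hc1 : ∀ i : ℕ, 1 - ((q ^ ν : ℝ) : ℂ) * (q : ℂ) * (q : ℂ) ^ i ≠ 0 := by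
    intro i h
    apply hc (i + 1)
    rw [← h]
    ring
  have hpow : ∀ k : ℕ, ((q ^ (ν + k) : ℝ) : ℂ) = ((q ^ ν : ℝ) : ℂ) * (q : ℂ) ^ k := by
    intro k
    rw [Real.rpow_add h0, Real.rpow_natCast]
    push_cast
    rfl
  have hJ : ∀ k : ℕ, ((q ^ ν : ℝ) : ℂ) * (q : ℂ) ^ k * J2 q (ν + (k + 1 : ℕ)) x
      = (x / 2)⁻¹ * (1 - ((q ^ ν : ℝ) : ℂ) * (q : ℂ) ^ k) * J2 q (ν + k) x
        - J2 q (ν + k - 1) x := by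
    intro k
    have h := J2_rec q (ν + k) x h0 h1 hx (by
      intro n
      have := hν0 (k + n)
      push_cast at this
      rwa [← add_assoc] at this)
    rw [hpow] at h
    rw [← h]
    push_cast
    rw [add_assoc]
  have hC : ∀ k : ℕ, ((q ^ (((k + 1 : ℕ) : ℝ) * ν + (((k + 1) * (k + 1 - 1) / 2 : ℕ) : ℝ)) : ℝ) : ℂ)
      = ((q ^ ((k : ℝ) * ν + ((k * (k - 1) / 2 : ℕ) : ℝ)) : ℝ) : ℂ)
        * (((q ^ ν : ℝ) : ℂ) * (q : ℂ) ^ k) := by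
    intro k
    rw [← hpow, ← Complex.ofReal_mul, ← Real.rpow_add h0]
    congr 2
    have : (k + 1) * (k + 1 - 1) / 2 = k * (k - 1) / 2 + k := by
      have := Finset.sum_range_id_mul_two k
      have h2 := Nat.triangle_succ k
      exact h2
    rw [this]
    push_cast
    ring
  rw [R2_eq q ν h0, R2_eq q (ν + 1) h0, p1]
  have main : ∀ n : ℕ,
      ((q ^ (((n + 1 : ℕ) : ℝ) * ν + (((n + 1) * (n + 1 - 1) / 2 : ℕ) : ℝ)) : ℝ) : ℂ)
          * J2 q (ν + (n + 1 : ℕ)) x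
        = lomR ((q ^ ν : ℝ) : ℂ) q (x / 2)⁻¹ (n + 1) * J2 q ν x
          - lomR (((q ^ ν : ℝ) : ℂ) * q) q (x / 2)⁻¹ n * J2 q (ν - 1) x := by
    have base : ((q ^ (((0 : ℕ) : ℝ) * ν + ((0 * (0 - 1) / 2 : ℕ) : ℝ)) : ℝ) : ℂ) = 1 := by
      simp
    have j0 := hJ 0
    have j1 := hJ 1
    rw [show ν + ((1 : ℕ) : ℝ) - 1 = ν by push_cast; ring] at j1
    rw [show ν + ((0 : ℕ) : ℝ) = ν by push_cast; ring] at j0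
    simp only [pow_zero, mul_one, pow_one, zero_add, Nat.reduceAdd] at j0 j1
    intro n
    induction n using Nat.twoStepInduction with
    | zero =>
      rw [hC 0, base, lomR_zero, zero_add, lomR_one _ _ _ hqq]
      linear_combination j0
    | one =>
      have c1 := hC 0
      rw [base] at c1
      simp only [zero_add] at c1
      rw [hC 1, c1, lomR_one _ _ _ hqq, lomR_rec _ _ _ hqq hc 0, lomR_zero, zero_add,
        lomR_one _ _ _ hqq]
      simp only [pow_zero, mul_one, pow_one, zero_add, Nat.reduceAdd]
      generalize ((q ^ ν : ℝ) : ℂ) = a at *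
      linear_combination a * j1 + (x / 2)⁻¹ * (1 - a * q) * j0
    | more n ih1 ih2 =>
      have j := hJ (n + 2)
      rw [show ν + ((n + 2 : ℕ) : ℝ) - 1 = ν + ((n + 1 : ℕ) : ℝ) by push_cast; ring] at j
      rw [hC (n + 2)]
      rw [show n + 2 = n + 1 + 1 from rfl] at *
      rw [hC (n + 1)] at ih2 ⊢
      rw [lomR_rec _ _ _ hqq hc (n + 1), lomR_rec _ _ _ hqq hc1 n]
      generalize ((q ^ ν : ℝ) : ℂ) = a at *
      generalize ((q ^ (((n + 1 : ℕ) : ℝ) * ν + (((n + 1) * (n + 1 - 1) / 2 : ℕ) : ℝ)) : ℝ) : ℂ)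
        = C at *
      linear_combination C * (a * q ^ (n + 1)) * j
        + (x / 2)⁻¹ * (1 - a * q ^ (n + 1 + 1)) * ih2 - a * q ^ (n + 1) * ih1
  obtain ⟨n, rfl⟩ := Nat.exists_eq_add_of_le' hm
  exact main n
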